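/- For every (p^d, p^c, s, u) ∈ 𝒫^{0-1}, every t ∈ {1,…,T}, and every τ̄ ∈ {0,…,T−t}, it holds that Σ_{τ=0}^{τ̄} p^c_{t+τ} + Σ_{τ=0}^{τ̄} ρ^c(t,τ,τ̄)(1 − u_{t+τ}) ≤ Σ_{τ=0}^{τ̄} c(t,τ). -/

import Mathlib

/-- Parameters of the energy storage system. -/
structure BatteryParams where
  Δ : ℝ
  ηc : ℝ
  ηd : ℝ
  Sl : ℝ
  Su : ℝ
  Pd : ℝ
  Pc : ℝ
  s0 : ℝ

namespace BatteryParams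

/-- Effective maximum discharge rate. -/
noncomputable def Pde (π : BatteryParams) : ℝ := min π.Pd (π.ηd * (π.Su - π.Sl) / π.Δ)

/-- Effective maximum charge rate. -/
noncomputable def Pce (π : BatteryParams) : ℝ := min π.Pc ((π.Su - π.Sl) / (π.Δ * π.ηc))

/-- Lower state-of-charge envelope. -/
noncomputable def slo (π : BatteryParams) : ℕ → ℝ
  | 0 => π.s0
  | t + 1 => max (π.slo t - (π.Δ / π.ηd) * π.Pde) π.Sl

/-- Upper state-of-charge envelope. -/
noncomputable def shi (π : BatteryParams) : ℕ → ℝ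
  | 0 => π.s0
  | t + 1 => min (π.shi t + π.Δ * π.ηc * π.Pce) π.Su

/-- Coefficient `c(t, τ)`. -/
noncomputable def c (π : BatteryParams) (t τ : ℕ) : ℝ :=
  min π.Pce (max ((π.Su - π.slo (t - 1)) / (π.Δ * π.ηc) - (τ : ℝ) * π.Pce) 0)

/-- Coefficient `d(t, τ)`. -/
noncomputable def d (π : BatteryParams) (t τ : ℕ) : ℝ :=
  min π.Pde (max ((π.shi (t - 1) - π.Sl) * π.ηd / π.Δ - (τ : ℝ) * π.Pde) 0)

/-- Coefficient `c̄(τ)`. -/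
noncomputable def cbar (π : BatteryParams) (τ : ℕ) : ℝ :=
  min π.Pce (max ((π.Su - π.Sl) / (π.Δ * π.ηc) - (τ : ℝ) * π.Pce) 0)

/-- Coefficient `d̄(τ)`. -/
noncomputable def dbar (π : BatteryParams) (τ : ℕ) : ℝ :=
  min π.Pde (max ((π.Su - π.Sl) * π.ηd / π.Δ - (τ : ℝ) * π.Pde) 0)

/-- Time-dependent effective charge rate `P̄^c_e(t) = c(t,0)`. -/
noncomputable def Pcet (π : BatteryParams) (t : ℕ) : ℝ := π.c t 0

/-- Time-dependent effective discharge rate `P̄^d_e(t) = d(t,0)`. -/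
noncomputable def Pdet (π : BatteryParams) (t : ℕ) : ℝ := π.d t 0

/-- Coefficient `ρ^c(t, τ, τ̄)` (the sum `Σ_{j=0}^{τ̄-τ-1}` is over `range (τ̄ - τ)`). -/
noncomputable def ρc (π : BatteryParams) (t τ tb : ℕ) : ℝ :=
  max (-(π.Pdet (t + τ)) / (π.ηd * π.ηc))
    ((∑ j ∈ Finset.Icc τ tb, π.c t j) - ∑ j ∈ Finset.range (tb - τ), π.cbar j)

/-- Coefficient `ρ^d(t, τ, τ̄)`. -/
noncomputable def ρd (π : BatteryParams) (t τ tb : ℕ) : ℝ :=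
  max (-(π.ηd * π.ηc * π.Pcet (t + τ)))
    ((∑ j ∈ Finset.Icc τ tb, π.d t j) - ∑ j ∈ Finset.range (tb - τ), π.dbar j)

/-- Coefficient `ρ̄^c(t, τ, τ̄)` (in Lean, `x / 0 = 0`). -/
noncomputable def ρbarc (π : BatteryParams) (t τ tb : ℕ) : ℝ :=
  if π.ρc t τ tb ≤ 0 then -(1 / (π.ηd * π.ηc)) else π.ρc t τ tb / π.Pdet (t + τ)

/-- Coefficient `ρ̄^d(t, τ, τ̄)` (in Lean, `x / 0 = 0`). -/
noncomputable def ρbard (π : BatteryParams) (t τ tb : ℕ) : ℝ :=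
  if π.ρd t τ tb ≤ 0 then -(π.ηd * π.ηc) else π.ρd t τ tb / π.Pcet (t + τ)

/-- The nonconvex storage feasible set `𝒫` (with `s 0` the initial state of charge). -/
def Feasible (π : BatteryParams) (T : ℕ) (pd pc s : ℕ → ℝ) : Prop :=
  s 0 = π.s0 ∧ ∀ t, 1 ≤ t → t ≤ T →
    0 ≤ pd t ∧ pd t ≤ π.Pd ∧ 0 ≤ pc t ∧ pc t ≤ π.Pc ∧
    π.Sl ≤ s t ∧ s t ≤ π.Su ∧
    s t = s (t - 1) + π.Δ * (π.ηc * pc t - pd t / π.ηd) ∧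
    pd t * pc t = 0

end BatteryParams

/-- The mixed-integer storage feasible set `𝒫^{0-1}`. -/
def BatteryParams.FeasibleMI (π : BatteryParams) (T : ℕ)
    (pd pc s u : ℕ → ℝ) : Prop :=
  s 0 = π.s0 ∧ ∀ t, 1 ≤ t → t ≤ T →
    (u t = 0 ∨ u t = 1) ∧
    0 ≤ pd t ∧ pd t ≤ π.Pd * (1 - u t) ∧
    0 ≤ pc t ∧ pc t ≤ π.Pc * u t ∧
    π.Sl ≤ s t ∧ s t ≤ π.Su ∧
    s t = s (t - 1) + π.Δ * (π.ηc * pc t - pd t / π.ηd)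

/-- Increments of the concave map `x ↦ min A x` decrease when it is shifted to the right or its
cap is lowered. -/
lemma min_add_sub_min_le {A R M K L : ℝ} (hAR : A ≤ R) (hL : 0 ≤ L) (hKM : K ≤ M) :
    min A (M + L) - min A M ≤ min R (K + L) - min R K := by
  rcases min_cases A (M + L) with h1 | h1 <;> rcases min_cases A M with h2 | h2 <;>
    rcases min_cases R (K + L) with h3 | h3 <;> rcases min_cases R K with h4 | h4 <;>
    linarith

/-- Filling a capacity `A` greedily by steps of size at most `P`. -/
lemma sum_min_max_sub_mul {A P : ℝ} (hA : 0 ≤ A) (hP : 0 ≤ P) (n : ℕ) :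
    ∑ j ∈ Finset.range n, min P (max (A - (j : ℝ) * P) 0) = min A (n * P) := by
  induction n with
  | zero => simp [hA]
  | succ n ih =>
    rw [Finset.sum_range_succ, ih]
    push_cast
    rcases max_cases (A - (n : ℝ) * P) 0 with h1 | h1 <;>
      rcases min_cases P (max (A - (n : ℝ) * P) 0) with h2 | h2 <;>
      rcases min_cases A (n * P) with h3 | h3 <;>
      rcases min_cases A (((n : ℝ) + 1) * P) with h4 | h4 <;>
      linarith

/-- Lifted bound for a sequence of charging steps (`z k = 0`) and discharging steps (`z k = 1`),
where `a k` is the free capacity before step `k`. -/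
lemma sum_charge_add_lifting_le {A R P : ℝ} (hP : 0 ≤ P) (hAR : A ≤ R) {n : ℕ}
    {x a D z : ℕ → ℝ} (ha : a 0 ≤ A) (ha0 : ∀ k ≤ n, 0 ≤ a k) (haR : ∀ k ≤ n, a k ≤ R)
    (hstep : ∀ k < n, (z k = 0 ∧ x k ≤ P ∧ x k ≤ a k - a (k + 1)) ∨
      (z k = 1 ∧ x k = 0 ∧ 0 ≤ D k ∧ -D k ≤ a k - a (k + 1))) :
    ∑ k ∈ Finset.range n, (x k + max (-D k)
      (min A (n * P) - min A (k * P) - min R (((n - 1 - k : ℕ) : ℝ) * P)) * z k)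
      ≤ min A (n * P) := by
  have key : ∀ m ≤ n, ∀ S : ℝ, S = ∑ k ∈ Finset.range m, (x k + max (-D k)
      (min A (n * P) - min A (k * P) - min R (((n - 1 - k : ℕ) : ℝ) * P)) * z k) →
      (S ≤ A - a m ∧ S ≤ m * P) ∨
      ∃ σ < m, S ≤ min A (n * P) - min R (((n - 1 - σ : ℕ) : ℝ) * P) +
        min (R - a m) (((m - 1 - σ : ℕ) : ℝ) * P) := by
    intro m
    induction m with
    | zero =>
      rintro - S rfl
      left
      simpa using ha
    | succ m ih =>
      intro hm S hS
      rw [Finset.sum_range_succ] at hS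
      have ih := ih (by omega) _ rfl
      set S₀ := ∑ k ∈ Finset.range m, (x k + max (-D k)
        (min A (n * P) - min A (k * P) - min R (((n - 1 - k : ℕ) : ℝ) * P)) * z k)
      have h0 := ha0 m (by omega)
      have hR := haR (m + 1) hm
      have small : ∀ w, S = S₀ + w → w ≤ P → w ≤ a m - a (m + 1) →
          (S ≤ A - a (m + 1) ∧ S ≤ ((m + 1 : ℕ) : ℝ) * P) ∨
          ∃ σ < m + 1, S ≤ min A (n * P) - min R (((n - 1 - σ : ℕ) : ℝ) * P) +
            min (R - a (m + 1)) (((m + 1 - 1 - σ : ℕ) : ℝ) * P) := by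
        intro w hw hwP hwa
        rcases ih with ⟨i1, i2⟩ | ⟨σ, hσ, i⟩
        · left
          push_cast
          constructor <;> linarith
        · refine Or.inr ⟨σ, by omega, ?_⟩
          have e : ((m + 1 - 1 - σ : ℕ) : ℝ) = ((m - 1 - σ : ℕ) : ℝ) + 1 := by
            rw [show m + 1 - 1 - σ = (m - 1 - σ) + 1 by omega]
            push_cast
            ring
          rw [e, ← sub_le_iff_le_add']
          refine le_min ?_ ?_
          · linarith [min_le_left (R - a m) (((m - 1 - σ : ℕ) : ℝ) * P)]
          · linarith [min_le_right (R - a m) (((m - 1 - σ : ℕ) : ℝ) * P)]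
      rcases hstep m (by omega) with ⟨hz, hxP, hxa⟩ | ⟨hz, hx, hD, hDa⟩
      · exact small (x m) (by rw [hS, hz]; ring) hxP hxa
      · rw [hz, hx, zero_add, mul_one] at hS
        rcases max_choice (-D m)
          (min A (n * P) - min A (m * P) - min R (((n - 1 - m : ℕ) : ℝ) * P)) with h | h
        · rw [h] at hS
          exact small _ hS (by linarith) hDa
        · rw [h] at hS
          refine Or.inr ⟨m, by omega, ?_⟩
          have e : m + 1 - 1 - m = 0 := by omega
          rw [e, Nat.cast_zero, zero_mul, min_eq_right (sub_nonneg.2 hR)]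
          rcases ih with ⟨i1, i2⟩ | ⟨σ, hσ, i⟩
          · have : S₀ ≤ min A (m * P) := le_min (by linarith) i2
            linarith
          · have hg : min (R - a m) (((m - 1 - σ : ℕ) : ℝ) * P) ≤
                min R (((m - 1 - σ : ℕ) : ℝ) * P) := min_le_min_right _ (by linarith)
            have hinc := min_add_sub_min_le (M := m * P) (K := ((m - 1 - σ : ℕ) : ℝ) * P)
              (L := ((n - m : ℕ) : ℝ) * P) hAR (by positivity)
              (mul_le_mul_of_nonneg_right (Nat.cast_le.2 (by omega)) hP)
            rw [← add_mul, ← add_mul, ← Nat.cast_add, ← Nat.cast_add,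
              show m + (n - m) = n by omega,
              show m - 1 - σ + (n - m) = n - 1 - σ by omega] at hinc
            linarith
  rcases key n le_rfl _ rfl with ⟨h1, h2⟩ | ⟨σ, hσ, h⟩
  · exact le_min (by linarith [ha0 n le_rfl]) h2
  · have : min (R - a n) (((n - 1 - σ : ℕ) : ℝ) * P) ≤ min R (((n - 1 - σ : ℕ) : ℝ) * P) :=
      min_le_min_right _ (by linarith [ha0 n le_rfl])
    linarith

namespace BatteryParams

variable {π : BatteryParams}

/-- In each period a feasible plan either only charges, at most at the effective rate, or only
discharges, at most at the effective rate. -/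
lemma FeasibleMI.step {T : ℕ} {pd pc s u : ℕ → ℝ} (h : π.FeasibleMI T pd pc s u)
    (hΔ : 0 < π.Δ) (hηc : 0 < π.ηc) (hηd : 0 < π.ηd) {t : ℕ} (ht : t + 1 ≤ T)
    (hl : π.Sl ≤ s t) (hu : s t ≤ π.Su) :
    (u (t + 1) = 1 ∧ 0 ≤ pc (t + 1) ∧ pc (t + 1) ≤ π.Pce ∧
      s (t + 1) = s t + π.Δ * π.ηc * pc (t + 1)) ∨
    (u (t + 1) = 0 ∧ pc (t + 1) = 0 ∧ 0 ≤ pd (t + 1) ∧ pd (t + 1) ≤ π.Pde ∧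
      s (t + 1) = s t - π.Δ / π.ηd * pd (t + 1)) := by
  obtain ⟨hu01, hd0, hd1, hc0, hc1, hsl, hsu, hs⟩ := h.2 (t + 1) (by omega) ht
  rw [Nat.add_sub_cancel] at hs
  rcases hu01 with h0 | h1
  · right
    rw [h0] at hd1 hc1
    have hc : pc (t + 1) = 0 := by linarith
    have e : s (t + 1) = s t - π.Δ / π.ηd * pd (t + 1) := by rw [hs, hc]; ring
    refine ⟨h0, hc, hd0, le_min (by linarith) ?_, e⟩
    rw [le_div_iff₀ hΔ]
    have : π.Δ / π.ηd * pd (t + 1) ≤ π.Su - π.Sl := by linarith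
    have h2 := mul_le_mul_of_nonneg_left this hηd.le
    have h3 : π.ηd * (π.Δ / π.ηd * pd (t + 1)) = pd (t + 1) * π.Δ := by field_simp
    linarith
  · left
    rw [h1] at hd1 hc1
    have hd : pd (t + 1) = 0 := by linarith
    have e : s (t + 1) = s t + π.Δ * π.ηc * pc (t + 1) := by rw [hs, hd]; ring
    refine ⟨h1, hc0, le_min (by linarith) ?_, e⟩
    rw [le_div_iff₀ (by positivity)]
    linarith

lemma FeasibleMI.mem_Icc {T : ℕ} {pd pc s u : ℕ → ℝ} (h : π.FeasibleMI T pd pc s u)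
    (hs1 : π.Sl ≤ π.s0) (hs2 : π.s0 ≤ π.Su) {t : ℕ} (ht : t ≤ T) :
    π.Sl ≤ s t ∧ s t ≤ π.Su := by
  rcases Nat.eq_zero_or_pos t with rfl | hp
  · rw [h.1]
    exact ⟨hs1, hs2⟩
  · obtain ⟨-, -, -, -, -, hsl, hsu, -⟩ := h.2 t hp ht
    exact ⟨hsl, hsu⟩

lemma Pde_nonneg (hΔ : 0 < π.Δ) (hηd : 0 < π.ηd) (hS : π.Sl ≤ π.Su) (hPd : 0 ≤ π.Pd) :
    0 ≤ π.Pde :=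
  le_min hPd (div_nonneg (mul_nonneg hηd.le (sub_nonneg.2 hS)) hΔ.le)

lemma Pce_nonneg (hΔ : 0 < π.Δ) (hηc : 0 < π.ηc) (hS : π.Sl ≤ π.Su) (hPc : 0 ≤ π.Pc) :
    0 ≤ π.Pce :=
  le_min hPc (div_nonneg (sub_nonneg.2 hS) (mul_pos hΔ hηc).le)

lemma Sl_le_slo (hs1 : π.Sl ≤ π.s0) : ∀ t, π.Sl ≤ π.slo t
  | 0 => hs1
  | _ + 1 => le_max_right _ _

/-- The state of charge of a feasible plan stays between the two envelopes. -/
lemma FeasibleMI.envelope {T : ℕ} {pd pc s u : ℕ → ℝ} (h : π.FeasibleMI T pd pc s u)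
    (hΔ : 0 < π.Δ) (hηc : 0 < π.ηc) (hηd : 0 < π.ηd) (hPd : 0 ≤ π.Pd) (hPc : 0 ≤ π.Pc)
    (hs1 : π.Sl ≤ π.s0) (hs2 : π.s0 ≤ π.Su) {t : ℕ} (ht : t ≤ T) :
    π.slo t ≤ s t ∧ s t ≤ π.shi t := by
  induction t with
  | zero => simp [slo, shi, h.1]
  | succ t ih =>
    obtain ⟨il, iu⟩ := ih (by omega)
    obtain ⟨hl, hu⟩ := h.mem_Icc hs1 hs2 (t := t) (by omega)
    obtain ⟨hl', hu'⟩ := h.mem_Icc hs1 hs2 ht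
    have hc : 0 < π.Δ * π.ηc := by positivity
    have hd : 0 < π.Δ / π.ηd := by positivity
    have hPde := mul_nonneg hd.le (Pde_nonneg hΔ hηd (hs1.trans hs2) hPd)
    have hPce := mul_nonneg hc.le (Pce_nonneg hΔ hηc (hs1.trans hs2) hPc)
    rcases h.step hΔ hηc hηd ht hl hu with ⟨-, h0, h1, e⟩ | ⟨-, -, h0, h1, e⟩
    · have m0 := mul_nonneg hc.le h0
      have m1 := mul_le_mul_of_nonneg_left h1 hc.le
      exact ⟨max_le (by linarith) hl', le_min (by linarith) hu'⟩
    · have m0 := mul_nonneg hd.le h0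
      have m1 := mul_le_mul_of_nonneg_left h1 hd.le
      exact ⟨max_le (by linarith) hl', le_min (by linarith) hu'⟩

lemma sum_c (hΔ : 0 < π.Δ) (hηc : 0 < π.ηc) (hPce : 0 ≤ π.Pce) {t : ℕ}
    (hA : π.slo (t - 1) ≤ π.Su) (n : ℕ) :
    ∑ j ∈ Finset.range n, π.c t j =
      min ((π.Su - π.slo (t - 1)) / (π.Δ * π.ηc)) (n * π.Pce) :=
  sum_min_max_sub_mul (div_nonneg (sub_nonneg.2 hA) (mul_pos hΔ hηc).le) hPce n

lemma sum_cbar (hΔ : 0 < π.Δ) (hηc : 0 < π.ηc) (hPce : 0 ≤ π.Pce) (hS : π.Sl ≤ π.Su) (n : ℕ) :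
    ∑ j ∈ Finset.range n, π.cbar j = min ((π.Su - π.Sl) / (π.Δ * π.ηc)) (n * π.Pce) :=
  sum_min_max_sub_mul (div_nonneg (sub_nonneg.2 hS) (mul_pos hΔ hηc).le) hPce n

/-- `ρc` in closed form. -/
lemma ρc_eq (hΔ : 0 < π.Δ) (hηc : 0 < π.ηc) (hPce : 0 ≤ π.Pce) (hS : π.Sl ≤ π.Su) {t τ tb : ℕ}
    (hA : π.slo (t - 1) ≤ π.Su) (hτ : τ ≤ tb) :
    π.ρc t τ tb = max (-(π.Pdet (t + τ) / (π.ηd * π.ηc)))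
      (min ((π.Su - π.slo (t - 1)) / (π.Δ * π.ηc)) ((tb + 1 : ℕ) * π.Pce) -
        min ((π.Su - π.slo (t - 1)) / (π.Δ * π.ηc)) (τ * π.Pce) -
        min ((π.Su - π.Sl) / (π.Δ * π.ηc)) ((tb + 1 - 1 - τ : ℕ) * π.Pce)) := by
  rw [ρc, neg_div, Nat.add_sub_cancel, ← sum_cbar hΔ hηc hPce hS, ← sum_c hΔ hηc hPce hA,
    ← sum_c hΔ hηc hPce hA, ← Finset.sum_Ico_eq_sub _ (by omega : τ ≤ tb + 1)]
  rfl

end BatteryParams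

/-- The valid inequality (18) in terms of the binary variables `u`. -/
theorem charging_valid_inequality_u (π : BatteryParams) (T : ℕ) (hT : 1 ≤ T)
    (hΔ : 0 < π.Δ) (hηc : 0 < π.ηc) (hηc1 : π.ηc ≤ 1)
    (hηd : 0 < π.ηd) (hηd1 : π.ηd ≤ 1)
    (hSl : 0 ≤ π.Sl) (hS : π.Sl < π.Su)
    (hPd : 0 ≤ π.Pd) (hPc : 0 ≤ π.Pc)
    (hs1 : π.Sl ≤ π.s0) (hs2 : π.s0 ≤ π.Su)
    (pd pc s u : ℕ → ℝ) (hfeas : π.FeasibleMI T pd pc s u)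
    (t : ℕ) (ht1 : 1 ≤ t) (htT : t ≤ T)
    (tb : ℕ) (htb : tb ≤ T - t) :
    (∑ τ ∈ Finset.range (tb + 1), pc (t + τ)) +
        (∑ τ ∈ Finset.range (tb + 1), π.ρc t τ tb * (1 - u (t + τ))) ≤
      ∑ τ ∈ Finset.range (tb + 1), π.c t τ := by
  obtain ⟨t, rfl⟩ : ∃ r, t = r + 1 := ⟨t - 1, by omega⟩
  have hc : 0 < π.Δ * π.ηc := by positivity
  have hPce := π.Pce_nonneg hΔ hηc hS.le hPc
  have hmem : ∀ k ≤ tb + 1, π.Sl ≤ s (t + k) ∧ s (t + k) ≤ π.Su := fun k hk =>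
    hfeas.mem_Icc hs1 hs2 (by omega)
  have henv : ∀ k ≤ tb + 1, π.slo (t + k) ≤ s (t + k) ∧ s (t + k) ≤ π.shi (t + k) := fun k hk =>
    hfeas.envelope hΔ hηc hηd hPd hPc hs1 hs2 (by omega)
  have hA : π.slo (t + 1 - 1) ≤ π.Su := (henv 0 (by omega)).1.trans (hmem 0 (by omega)).2
  rw [BatteryParams.sum_c hΔ hηc hPce hA, ← Finset.sum_add_distrib]
  refine (Finset.sum_congr rfl fun τ hτ => ?_).trans_le
    (sum_charge_add_lifting_le (R := (π.Su - π.Sl) / (π.Δ * π.ηc))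
      (x := fun k => pc (t + 1 + k)) (a := fun k => (π.Su - s (t + k)) / (π.Δ * π.ηc))
      (D := fun k => π.Pdet (t + 1 + k) / (π.ηd * π.ηc)) (z := fun k => 1 - u (t + 1 + k))
      hPce ?_ ?_ ?_ ?_ ?_)
  · rw [BatteryParams.ρc_eq hΔ hηc hPce hS.le hA (by simp at hτ; omega)]
  · exact div_le_div_of_nonneg_right
      (by linarith [BatteryParams.Sl_le_slo hs1 (t + 1 - 1)]) hc.le
  · exact div_le_div_of_nonneg_right (sub_le_sub_left (henv 0 (by omega)).1 _) hc.le
  · exact fun k hk => div_nonneg (sub_nonneg.2 (hmem k hk).2) hc.le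
  · exact fun k hk => div_le_div_of_nonneg_right (sub_le_sub_left (hmem k hk).1 _) hc.le
  · intro k hk
    simp only [show t + 1 + k = t + k + 1 by omega, ← add_assoc]
    obtain ⟨hl, hu⟩ := hmem k hk.le
    have hhi := (henv k hk.le).2
    rcases hfeas.step hΔ hηc hηd (by omega) hl hu with ⟨hu1, h0, h1, e⟩ | ⟨hu0, hpc, h0, h1, e⟩
    · refine Or.inl ⟨by rw [hu1, sub_self], h1, le_of_eq ?_⟩
      rw [e]
      field_simp
      ring
    · have hlow := (hmem (k + 1) hk).1
      rw [← add_assoc] at hlow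
      have hD : pd (t + k + 1) ≤ π.Pdet (t + k + 1) := by
        refine le_min h1 (le_max_of_le_left ?_)
        rw [Nat.cast_zero, zero_mul, sub_zero, Nat.add_sub_cancel, le_div_iff₀ hΔ,
          ← div_le_iff₀ hηd]
        have : pd (t + k + 1) * π.Δ / π.ηd = π.Δ / π.ηd * pd (t + k + 1) := by ring
        linarith
      have hcd : 0 < π.ηd * π.ηc := by positivity
      refine Or.inr ⟨by rw [hu0, sub_zero], hpc, div_nonneg (h0.trans hD) hcd.le, ?_⟩
      have h2 : (π.Su - s (t + k)) / (π.Δ * π.ηc) - (π.Su - s (t + k + 1)) / (π.Δ * π.ηc) =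
          -(pd (t + k + 1) / (π.ηd * π.ηc)) := by
        rw [e]
        field_simp
        ring
      rw [h2]
      exact neg_le_neg (div_le_div_of_nonneg_right hD hcd.le)
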